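/- The logic Box = wPL ⊕ bw_2 ⊕ (¬p ∨ ¬¬p) is pre-uniformly locally tabular: Box is not uniformly locally tabular, but every superintuitionistic logic properly extending Box is uniformly locally tabular. -/

import Mathlib

/-! # Common framework: superintuitionistic logics, Kripke frames and models -/

/-! ## Intuitionistic propositional formulas -/

inductive Form : Type
  | var : ℕ → Form
  | bot : Form
  | top : Form
  | and : Form → Form → Form
  | or  : Form → Form → Form
  | imp : Form → Form → Form
deriving DecidableEq

namespace Form

/-- Implication depth of a formula. -/
def depth : Form → ℕ
  | var _ => 0
  | bot => 0
  | top => 0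
  | and φ ψ => max φ.depth ψ.depth
  | or φ ψ => max φ.depth ψ.depth
  | imp φ ψ => max φ.depth ψ.depth + 1

/-- All propositional variables of the formula are among `p_0, …, p_{m-1}`. -/
def varsLt (m : ℕ) : Form → Prop
  | var p => p < m
  | bot => True
  | top => True
  | and φ ψ => φ.varsLt m ∧ ψ.varsLt m
  | or φ ψ => φ.varsLt m ∧ ψ.varsLt m
  | imp φ ψ => φ.varsLt m ∧ ψ.varsLt m

/-- Uniform substitution. -/
def subst (σ : ℕ → Form) : Form → Form
  | var p => σ p
  | bot => bot
  | top => top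
  | and φ ψ => and (φ.subst σ) (ψ.subst σ)
  | or φ ψ => or (φ.subst σ) (ψ.subst σ)
  | imp φ ψ => imp (φ.subst σ) (ψ.subst σ)

/-- Biconditional. -/
def iff (φ ψ : Form) : Form := and (imp φ ψ) (imp ψ φ)

/-- Negation. -/
def neg (φ : Form) : Form := imp φ bot

end Form

/-! ## IPC and superintuitionistic logics -/

/-- A Hilbert-style axiomatization of intuitionistic propositional logic. -/
inductive IPC : Form → Prop
  | ax1 (φ ψ : Form) : IPC (.imp φ (.imp ψ φ))
  | ax2 (φ ψ χ : Form) :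
      IPC (.imp (.imp φ (.imp ψ χ)) (.imp (.imp φ ψ) (.imp φ χ)))
  | andE1 (φ ψ : Form) : IPC (.imp (.and φ ψ) φ)
  | andE2 (φ ψ : Form) : IPC (.imp (.and φ ψ) ψ)
  | andI (φ ψ : Form) : IPC (.imp φ (.imp ψ (.and φ ψ)))
  | orI1 (φ ψ : Form) : IPC (.imp φ (.or φ ψ))
  | orI2 (φ ψ : Form) : IPC (.imp ψ (.or φ ψ))
  | orE (φ ψ χ : Form) :
      IPC (.imp (.imp φ χ) (.imp (.imp ψ χ) (.imp (.or φ ψ) χ)))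
  | botE (φ : Form) : IPC (.imp .bot φ)
  | topI : IPC .top
  | mp (φ ψ : Form) : IPC (.imp φ ψ) → IPC φ → IPC ψ

/-- The set of theorems of IPC. -/
def IPCSet : Set Form := {φ | IPC φ}

/-- A superintuitionistic logic: a set of formulas containing all theorems of
IPC, closed under modus ponens and uniform substitution. -/
def IsSILogic (L : Set Form) : Prop :=
  IPCSet ⊆ L ∧
  (∀ φ ψ : Form, Form.imp φ ψ ∈ L → φ ∈ L → ψ ∈ L) ∧
  (∀ (φ : Form) (σ : ℕ → Form), φ ∈ L → φ.subst σ ∈ L)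

/-- `oplus L Γ` is the least superintuitionistic logic containing `L` and `Γ`
(written `L ⊕ Γ`). -/
def oplus (L Γ : Set Form) : Set Form :=
  ⋂₀ {M : Set Form | IsSILogic M ∧ L ⊆ M ∧ Γ ⊆ M}

/-- A logic is `n`-uniform if every formula is provably equivalent in it to a
formula of implication depth at most `n`. -/
def Uniform (L : Set Form) (n : ℕ) : Prop :=
  ∀ φ : Form, ∃ ψ : Form, ψ.depth ≤ n ∧ Form.iff φ ψ ∈ L

/-- A logic is locally tabular if over each finite tuple of variables there are
only finitely many formulas up to provable equivalence. -/
def LocallyTabular (L : Set Form) : Prop :=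
  ∀ m : ℕ, ∃ Φ : Finset Form, ∀ φ : Form, φ.varsLt m → ∃ ψ ∈ Φ, Form.iff φ ψ ∈ L

/-! ## Kripke frames (posets) -/

structure Frame : Type 1 where
  W : Type
  le : W → W → Prop
  refl : ∀ x, le x x
  trans : ∀ x y z, le x y → le y z → le x z
  antisymm : ∀ x y, le x y → le y x → x = y

namespace Frame

def lt (F : Frame) (a b : F.W) : Prop := F.le a b ∧ a ≠ b

/-- A valuation is persistent if it is preserved upwards. -/
def Persistent (F : Frame) (V : ℕ → F.W → Prop) : Prop :=
  ∀ p a b, F.le a b → V p a → V p b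

/-- Kripke forcing. -/
def force (F : Frame) (V : ℕ → F.W → Prop) : Form → F.W → Prop
  | .var p, w => V p w
  | .bot, _ => False
  | .top, _ => True
  | .and φ ψ, w => F.force V φ w ∧ F.force V ψ w
  | .or φ ψ, w => F.force V φ w ∨ F.force V ψ w
  | .imp φ ψ, w => ∀ v, F.le w v → F.force V φ v → F.force V ψ v

/-- `F ⊩ φ`. -/
def Valid (F : Frame) (φ : Form) : Prop :=
  ∀ V : ℕ → F.W → Prop, F.Persistent V → ∀ w : F.W, F.force V φ w

def Rooted (F : Frame) : Prop := ∃ r, ∀ w, F.le r w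

/-- The subposet on a subset of the carrier. -/
def restrict (F : Frame) (s : Set F.W) : Frame where
  W := s
  le a b := F.le a.1 b.1
  refl a := F.refl a.1
  trans a b c h1 h2 := F.trans a.1 b.1 c.1 h1 h2
  antisymm a b h1 h2 := Subtype.ext (F.antisymm a.1 b.1 h1 h2)

/-- The rooted upset `↑z`. -/
def up (F : Frame) (z : F.W) : Frame := F.restrict {w | F.le z w}

/-- There is a chain of `d` elements in `↑w` starting at `w`. -/
def hasChainUp (F : Frame) (w : F.W) (d : ℕ) : Prop :=
  ∃ f : Fin d → F.W, (∀ i : Fin d, (i : ℕ) = 0 → f i = w) ∧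
    (∀ i j : Fin d, (i : ℕ) < (j : ℕ) → F.lt (f i) (f j))

/-- The depth of `w` is `d`: the longest chain in `↑w` has exactly `d` elements. -/
def depthEq (F : Frame) (w : F.W) (d : ℕ) : Prop :=
  F.hasChainUp w d ∧ ¬ F.hasChainUp w (d + 1)

/-- The covering relation of the poset. -/
def covBy (F : Frame) (a b : F.W) : Prop :=
  F.lt a b ∧ ∀ c, F.lt a c → F.lt c b → False

end Frame

/-- A p-morphism of posets. -/
def IsPMorphism (P Q : Frame) (f : P.W → Q.W) : Prop :=
  (∀ a b, P.le a b → Q.le (f a) (f b)) ∧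
  (∀ a b, Q.le (f a) b → ∃ a', P.le a a' ∧ f a' = b)

/-- `Q` is a p-morphic image of `P`. -/
def PMorphicImage (P Q : Frame) : Prop :=
  ∃ f : P.W → Q.W, IsPMorphism P Q f ∧ Function.Surjective f

/-- Order isomorphism of posets. -/
def FrameIso (P Q : Frame) : Prop :=
  ∃ f : P.W → Q.W, Function.Bijective f ∧ ∀ a b, P.le a b ↔ Q.le (f a) (f b)

/-- The logic of a class of posets. -/
def LogK (K : Set Frame) : Set Form := {φ | ∀ F ∈ K, F.Valid φ}

/-- The logic of a single poset. -/
def FrameLog (F : Frame) : Set Form := {φ | F.Valid φ}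

/-- `J` is a Yankov formula for the finite rooted poset `Q`: a finite poset
refutes `J` exactly when `Q` is isomorphic to a rooted upset of one of its
p-morphic images. -/
def IsYankov (J : Form) (Q : Frame) : Prop :=
  ∀ P : Frame, Finite P.W →
    (¬ P.Valid J ↔ ∃ G : Frame, PMorphicImage P G ∧ ∃ z : G.W, FrameIso (G.up z) Q)

/-! ## Rooted Kripke models over `n` propositional variables -/

structure Model (n : ℕ) : Type 1 where
  W : Type
  le : W → W → Prop
  refl : ∀ x, le x x
  trans : ∀ x y z, le x y → le y z → le x z
  antisymm : ∀ x y, le x y → le y x → x = y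
  root : W
  rooted : ∀ w, le root w
  col : W → Set (Fin n)
  mono : ∀ a b, le a b → col a ⊆ col b

namespace Model

/-- The underlying poset of a model. -/
def frame {n : ℕ} (M : Model n) : Frame :=
  ⟨M.W, M.le, M.refl, M.trans, M.antisymm⟩

def force {n : ℕ} (M : Model n) : Form → M.W → Prop
  | .var p, w => ∃ h : p < n, (⟨p, h⟩ : Fin n) ∈ M.col w
  | .bot, _ => False
  | .top, _ => True
  | .and φ ψ, w => M.force φ w ∧ M.force ψ w
  | .or φ ψ, w => M.force φ w ∨ M.force ψ w
  | .imp φ ψ, w => ∀ v, M.le w v → M.force φ v → M.force ψ v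

/-- Satisfaction at the root of the model. -/
def Sat {n : ℕ} (M : Model n) (φ : Form) : Prop := M.force φ M.root

/-- (Full) bisimilarity of two rooted models. -/
def Bisim {n : ℕ} (M N : Model n) : Prop :=
  ∃ S : M.W → N.W → Prop,
    S M.root N.root ∧
    (∀ a b, S a b → M.col a = N.col b) ∧
    (∀ a b a', S a b → M.le a a' → ∃ b', N.le b b' ∧ S a' b') ∧
    (∀ a b b', S a b → N.le b b' → ∃ a', M.le a a' ∧ S a' b')

/-- `k`-bisimilarity of the points `x, y`, via a decreasing chain
`S k ⊆ ⋯ ⊆ S 0` of relations. -/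
def NBisimAt {n : ℕ} (M N : Model n) (k : ℕ) (x : M.W) (y : N.W) : Prop :=
  ∃ S : ℕ → M.W → N.W → Prop,
    (∀ j a b, S (j + 1) a b → S j a b) ∧
    S k x y ∧
    (∀ a b, S 0 a b → M.col a = N.col b) ∧
    (∀ j a b a', j < k → S (j + 1) a b → M.le a a' →
        ∃ b', N.le b b' ∧ S j a' b') ∧
    (∀ j a b b', j < k → S (j + 1) a b → N.le b b' →
        ∃ a', M.le a a' ∧ S j a' b')

/-- `k`-bisimilarity of two rooted models. -/
def NBisim {n : ℕ} (M N : Model n) (k : ℕ) : Prop :=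
  NBisimAt M N k M.root N.root

/-- The submodel on the rooted upset `↑z`. -/
def up {n : ℕ} (M : Model n) (z : M.W) : Model n where
  W := {w : M.W // M.le z w}
  le a b := M.le a.1 b.1
  refl a := M.refl a.1
  trans a b c h1 h2 := M.trans a.1 b.1 c.1 h1 h2
  antisymm a b h1 h2 := Subtype.ext (M.antisymm a.1 b.1 h1 h2)
  root := ⟨z, M.refl z⟩
  rooted w := w.2
  col a := M.col a.1
  mono a b h := M.mono a.1 b.1 h

/-- `(M, x) ≤ₖ (N, y)`: there is `z ≥ x` such that `(↑z, z)` is `k`-bisimilar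
with `(N, y)`. -/
def LeBisim {n : ℕ} (M N : Model n) (k : ℕ) : Prop :=
  ∃ z : M.W, M.le M.root z ∧ NBisim (M.up z) N k

/-- Two points of a model are bisimilar. -/
def PointsBisim {n : ℕ} (M : Model n) (a b : M.W) : Prop :=
  ∃ S : M.W → M.W → Prop,
    S a b ∧
    (∀ x y, S x y → M.col x = M.col y) ∧
    (∀ x y x', S x y → M.le x x' → ∃ y', M.le y y' ∧ S x' y') ∧
    (∀ x y y', S x y → M.le y y' → ∃ x', M.le x x' ∧ S x' y')

/-- A model over `n` variables is (`n`-)generated if it contains no two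
distinct bisimilar points. -/
def Generated {n : ℕ} (M : Model n) : Prop :=
  ∀ a b : M.W, M.PointsBisim a b → a = b

/-- Isomorphism of models: a root-preserving, color-preserving order
isomorphism. -/
def Iso {n : ℕ} (M N : Model n) : Prop :=
  ∃ f : M.W → N.W, Function.Bijective f ∧ f M.root = N.root ∧
    (∀ a b, M.le a b ↔ N.le (f a) (f b)) ∧ (∀ a, N.col (f a) = M.col a)

/-- `M` is a model over the class of posets `K`: its underlying poset is a
p-morphic image of a rooted upset of a member of `K`. -/
def InClass {n : ℕ} (K : Set Frame) (M : Model n) : Prop :=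
  ∃ F ∈ K, ∃ z : F.W, PMorphicImage (F.up z) M.frame

/-- The model on the rooted upset `↑z` of a frame `F`, with coloring `c`. -/
def ofFrame (F : Frame) (z : F.W) (n : ℕ) (c : (F.up z).W → Set (Fin n))
    (hc : ∀ a b : (F.up z).W, (F.up z).le a b → c a ⊆ c b) : Model n where
  W := (F.up z).W
  le := (F.up z).le
  refl := (F.up z).refl
  trans := (F.up z).trans
  antisymm := (F.up z).antisymm
  root := ⟨z, F.refl z⟩
  rooted w := w.2
  col := c
  mono := hc

end Model

/-! ## Boolean sums and stacks -/

/-- A (finite rooted) poset is a Boolean sum: it is rooted, covers decrease the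
depth by exactly one, and every point of depth `k+1` lies below every point of
depth `k`. -/
def IsBooleanSum (F : Frame) : Prop :=
  F.Rooted ∧
  (∀ a b da db, F.covBy a b → F.depthEq a da → F.depthEq b db → da = db + 1) ∧
  (∀ a b k, F.depthEq a (k + 1) → F.depthEq b k → F.le a b)

/-- `F` contains a `k`-stack: `k` consecutive layers (sets of points of equal
depth) each containing at least two points. -/
def HasStack (F : Frame) (k : ℕ) : Prop :=
  ∃ j : ℕ, ∀ i : ℕ, j ≤ i → i < j + k →
    ∃ a b : F.W, a ≠ b ∧ F.depthEq a i ∧ F.depthEq b i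

/-! ## The posets Q₁, …, Q₈ -/

def q1le : Fin 4 → Fin 4 → Bool := fun a b =>
  a = b || a = 0 || (a = 1 && b = 3)
def q2le : Fin 5 → Fin 5 → Bool := fun a b =>
  a = b || a = 0 || (a = 1 && (b = 3 || b = 4)) || (a = 2 && b = 4)
def q3le : Fin 5 → Fin 5 → Bool := fun a b =>
  a = b || a = 0 || (a = 1 && b = 4) || (a = 2 && (b = 3 || b = 4)) ||
    (a = 3 && b = 4)
def q4le : Fin 5 → Fin 5 → Bool := fun a b =>
  a = b || a = 0 || ((a = 1 || a = 2) && (b = 3 || b = 4))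
def q5le : Fin 6 → Fin 6 → Bool := fun a b =>
  a = b || a = 0 || b = 5 || ((a = 1 || a = 2) && (b = 3 || b = 4))
def q6le : Fin 4 → Fin 4 → Bool := fun a b =>
  a = b || a = 0 || b = 3
def q7le : Fin 5 → Fin 5 → Bool := fun a b =>
  a = b || a = 0 || (a = 1 && b = 3) || (a = 2 && b = 4)
def q8le : Fin 4 → Fin 4 → Bool := fun a b =>
  a = b || a = 0

/-- `Q₁`: root `0`; immediate successors `1`, `2`; `2` maximal; `3` the unique
(maximal) immediate successor of `1`. -/
def Q1f : Frame :=
  ⟨Fin 4, fun a b => q1le a b = true, by decide, by decide, by decide⟩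
/-- `Q₂`: root `0`; immediate successors `1`, `2`; maximal points `3`, `4`;
`1 < 3`, `1 < 4`, `2 < 4`, `2 ≮ 3`. -/
def Q2f : Frame :=
  ⟨Fin 5, fun a b => q2le a b = true, by decide, by decide, by decide⟩
/-- `Q₃`: root `0`; immediate successors `1`, `2`; `3` covers `2`; top `4`
with `1 < 4` and `3 < 4`. -/
def Q3f : Frame :=
  ⟨Fin 5, fun a b => q3le a b = true, by decide, by decide, by decide⟩
/-- `Q₄`: root `0`; `1`, `2` cover the root; maximal `3`, `4` above both `1`
and `2`. -/
def Q4f : Frame :=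
  ⟨Fin 5, fun a b => q4le a b = true, by decide, by decide, by decide⟩
/-- `Q₅`: `Q₄` with a greatest element `5` added on top. -/
def Q5f : Frame :=
  ⟨Fin 6, fun a b => q5le a b = true, by decide, by decide, by decide⟩
/-- `Q₆`: the diamond. -/
def Q6f : Frame :=
  ⟨Fin 4, fun a b => q6le a b = true, by decide, by decide, by decide⟩
/-- `Q₇`: root `0`; `1 < 3`, `2 < 4`, and no other strict relations above the
root. -/
def Q7f : Frame :=
  ⟨Fin 5, fun a b => q7le a b = true, by decide, by decide, by decide⟩
/-- `Q₈`: a root with three pairwise incomparable maximal points. -/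
def Q8f : Frame :=
  ⟨Fin 4, fun a b => q8le a b = true, by decide, by decide, by decide⟩

/-! ## Particular logics -/

/-- The one-element poset. -/
def unitFrame : Frame :=
  ⟨PUnit, fun _ _ => True, fun _ => trivial, fun _ _ _ _ _ => trivial,
    fun a b _ _ => Subsingleton.elim a b⟩

/-- The two-element chain. -/
def chain2 : Frame :=
  ⟨Bool, fun a b => a ≤ b, le_refl, fun _ _ _ => le_trans,
    fun _ _ => le_antisymm⟩

/-- Classical propositional logic: the logic of the one-element poset. -/
def CPC : Set Form := FrameLog unitFrame

/-- The logic of the two-element chain. -/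
def Sme : Set Form := FrameLog chain2

/-- The weak Peirce law `(q → p) ∨ (((p → q) → p) → p)`. -/
def wPLax : Form :=
  .or (.imp (.var 1) (.var 0))
    (.imp (.imp (.imp (.var 0) (.var 1)) (.var 0)) (.var 0))

/-- The logic `wPL = IPC ⊕ (q → p) ∨ (((p → q) → p) → p)`. -/
def wPL : Set Form := oplus IPCSet {wPLax}

/-- The bounded-width-2 axiom `⋁_{i≤2} (pᵢ → ⋁_{j≠i} pⱼ)`. -/
def bw2ax : Form :=
  .or (.imp (.var 0) (.or (.var 1) (.var 2)))
    (.or (.imp (.var 1) (.or (.var 0) (.var 2)))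
      (.imp (.var 2) (.or (.var 0) (.var 1))))

/-- The axiom `¬p ∨ ¬¬p`. -/
def kcax : Form := .or (Form.neg (.var 0)) (Form.neg (Form.neg (.var 0)))

/-- The logic `Box = wPL ⊕ bw₂ ⊕ (¬p ∨ ¬¬p)`. -/
def BoxLogic : Set Form := oplus wPL {bw2ax, kcax}

/-- The bounded-depth formulas. -/
def bd : ℕ → Form
  | 0 => .var 0
  | n + 1 => .or (.var (n + 1)) (.imp (.var (n + 1)) (bd n))

/-- The logic `BD_n = IPC ⊕ bd_n`. -/
def BD (n : ℕ) : Set Form := oplus IPCSet {bd n}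

/-- A logic is of finite depth if it contains some `BD_n`. -/
def FiniteDepth (L : Set Form) : Prop := ∃ n, BD n ⊆ L

/-! ## The Rieger–Nishimura ladder -/

/-- Points of the Rieger–Nishimura ladder: `inl k = L_k`, `inr k = R_k`. -/
abbrev RNpt : Type := ℕ ⊕ ℕ

/-- The covering relation of the Rieger–Nishimura ladder (`rnCov a b` means
`a ⋖ b`, i.e. `b` is an immediate successor of `a`). -/
inductive rnCov : RNpt → RNpt → Prop
  | ll (k : ℕ) : rnCov (.inl (k + 1)) (.inl k)
  | rr (k : ℕ) : rnCov (.inr (k + 1)) (.inr k)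
  | rl (k : ℕ) : rnCov (.inr (k + 1)) (.inl k)
  | lr (k : ℕ) : rnCov (.inl (k + 2)) (.inr k)

private def rnIdx : RNpt → ℕ
  | .inl k => 2 * k
  | .inr k => 2 * k + 1

private theorem rnCov_idx {a b : RNpt} (h : rnCov a b) : rnIdx b < rnIdx a := by
  cases h <;> simp [rnIdx] <;> omega

private theorem rnLe_idx {a b : RNpt} (h : Relation.ReflTransGen rnCov a b) :
    rnIdx b ≤ rnIdx a := by
  induction h with
  | refl => exact le_rfl
  | tail _ h₂ ih => exact le_trans (le_of_lt (rnCov_idx h₂)) ih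

private theorem rnIdx_inj {a b : RNpt} (h : rnIdx a = rnIdx b) : a = b := by
  rcases a with a | a <;> rcases b with b | b <;> simp [rnIdx] at h ⊢ <;> omega

/-- The Rieger–Nishimura ladder as a poset: the order is the reflexive
transitive closure of the covering relation. -/
def RN : Frame where
  W := RNpt
  le a b := Relation.ReflTransGen rnCov a b
  refl _ := Relation.ReflTransGen.refl
  trans _ _ _ h1 h2 := h1.trans h2
  antisymm _ _ h1 h2 := rnIdx_inj (le_antisymm (rnLe_idx h2) (rnLe_idx h1))

/-! ## Combs -/

def combLe (n : ℕ) : (Fin n ⊕ Fin n) → (Fin n ⊕ Fin n) → Prop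
  | .inl i, .inl j => i ≤ j
  | .inl i, .inr j => i ≤ j
  | .inr i, .inr j => i = j
  | .inr _, .inl _ => False

/-- The `n`-comb: base points `x_1 ≤ … ≤ x_n` (encoded `inl 0, …, inl (n-1)`)
and maximal teeth `y_1, …, y_n` (encoded `inr 0, …, inr (n-1)`), with
`x_i ≤ y_j ↔ i ≤ j` and the teeth pairwise incomparable. -/
def Comb (n : ℕ) : Frame where
  W := Fin n ⊕ Fin n
  le := combLe n
  refl := by rintro (i | i) <;> simp [combLe]
  trans := by
    rintro (i | i) (j | j) (k | k) h1 h2 <;> simp only [combLe] at * <;>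
      first
        | exact le_trans h1 h2
        | exact h2 ▸ h1
  antisymm := by
    rintro (i | i) (j | j) h1 h2 <;> simp only [combLe] at * <;>
      first
        | exact congrArg Sum.inl (le_antisymm h1 h2)
        | exact congrArg Sum.inr h1

/-- A broken `m`-comb: (isomorphic to) a subposet of the `m`-comb containing
all of the base points `x_1, …, x_m`. -/
def IsBrokenComb (F : Frame) (m : ℕ) : Prop :=
  ∃ s : Set (Comb m).W, (∀ i : Fin m, Sum.inl i ∈ s) ∧
    FrameIso F ((Comb m).restrict s)

/-- The logic of the class of all combs. -/
def LFC : Set Form := LogK {F | ∃ n, F = Comb n}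

/-! ## The stacked models `M_n^k` and `N_n^k` -/

/-- Height index of a point: layer `j` (from the top) has index `j`, the root
(`none`) has index `k+1`. -/
def stackIdx (k : ℕ) : Option (Fin (k + 1) × Bool) → ℕ
  | none => k + 1
  | some (j, _) => j

/-- Size of the color (an initial segment of the variables): the left point
(`false`) of layer `j` gets `1^{n-j}0^j`, the right point (`true`) gets
`1^{n-j-1}0^{j+1}`, and the root gets `1^r0^{n-r}`. -/
def stackColSize (n k r : ℕ) : Option (Fin (k + 1) × Bool) → ℕ
  | none => r
  | some (j, false) => n - j
  | some (j, true) => n - ((j : ℕ) + 1)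

private theorem stackColSize_le (n k r : ℕ) (hr : r ≤ n - (k + 1))
    {a b : Option (Fin (k + 1) × Bool)} (h : stackIdx k b < stackIdx k a) :
    stackColSize n k r a ≤ stackColSize n k r b := by
  rcases a with _ | ⟨j, _ | _⟩ <;> rcases b with _ | ⟨j', _ | _⟩ <;>
    simp only [stackIdx, stackColSize] at * <;> omega

/-- The common shape of `M_n^k` and `N_n^k`, with root color `1^r0^{n-r}`:
`k+1` layers of two points stacked on top of a root. -/
def stackModel (n k r : ℕ) (hr : r ≤ n - (k + 1)) : Model n where
  W := Option (Fin (k + 1) × Bool)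
  le a b := a = b ∨ stackIdx k b < stackIdx k a
  refl _ := Or.inl rfl
  trans := by
    rintro a b c (rfl | h1) h2
    · exact h2
    · rcases h2 with rfl | h2
      · exact Or.inr h1
      · exact Or.inr (h2.trans h1)
  antisymm := by
    rintro a b (rfl | h1) h2
    · rfl
    · rcases h2 with rfl | h2
      · rfl
      · omega
  root := none
  rooted := by
    rintro (_ | ⟨j, s⟩)
    · exact Or.inl rfl
    · exact Or.inr j.isLt
  col a := {i : Fin n | (i : ℕ) < stackColSize n k r a}
  mono := by
    rintro a b (rfl | h) i hi
    · exact hi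
    · exact lt_of_lt_of_le hi (stackColSize_le n k r hr h)

/-- The model `M_n^k` (root color `1^{n-k-1}0^{k+1}`). -/
def Mmodel (n k : ℕ) : Model n := stackModel n k (n - (k + 1)) le_rfl

/-- The model `N_n^k` (root color `1^{n-k-2}0^{k+2}`). -/
def Nmodel (n k : ℕ) : Model n := stackModel n k (n - (k + 2)) (by omega)

/-! ## The frames `S_n` -/

/-- Height index in `S_n`: the top point (`some none`) has index `0`, the two
points of the `j`-th middle layer have index `j+1`, and the root (`none`) has
index `n`. -/
def sIdx (n : ℕ) : Option (Option (Fin (n - 1) × Bool)) → ℕ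
  | none => n
  | some none => 0
  | some (some (j, _)) => (j : ℕ) + 1

/-- The frame `S_n` (for `n ≥ 2`): the Boolean sum whose layers from top to
bottom have sizes `1, 2, …, 2, 1` (with `n - 1` layers of size `2`). -/
def SFrame (n : ℕ) : Frame where
  W := Option (Option (Fin (n - 1) × Bool))
  le a b := a = b ∨ sIdx n b < sIdx n a
  refl _ := Or.inl rfl
  trans := by
    rintro a b c (rfl | h1) h2
    · exact h2
    · rcases h2 with rfl | h2
      · exact Or.inr h1
      · exact Or.inr (h2.trans h1)
  antisymm := by
    rintro a b (rfl | h1) h2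
    · rfl
    · rcases h2 with rfl | h2
      · rfl
      · omega


/-! ## Theories -/

namespace BoxProof

open Form

/-- A set of formulas containing IPC and closed under modus ponens. -/
def IsTh (x : Set Form) : Prop :=
  (∀ φ, IPC φ → φ ∈ x) ∧ ∀ φ ψ, imp φ ψ ∈ x → φ ∈ x → ψ ∈ x

/-- Relativised theory. -/
def th (x : Set Form) (α : Form) : Set Form := {β | imp α β ∈ x}

section
variable {x : Set Form} (hx : IsTh x)
include hx

theorem IsTh.mp {α β : Form} (h : imp α β ∈ x) (h' : α ∈ x) : β ∈ x := hx.2 _ _ h h'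

theorem IsTh.weak {α β : Form} (h : β ∈ x) : imp α β ∈ x :=
  hx.mp (hx.1 _ (IPC.ax1 β α)) h

theorem IsTh.id (α : Form) : imp α α ∈ x :=
  hx.mp (hx.mp (hx.1 _ (IPC.ax2 α (imp α α) α)) (hx.1 _ (IPC.ax1 _ _))) (hx.1 _ (IPC.ax1 _ _))

theorem isTh_th (α : Form) : IsTh (th x α) :=
  ⟨fun _ h => hx.weak (hx.1 _ h), fun φ ψ h h' => hx.mp (hx.mp (hx.1 _ (IPC.ax2 α φ ψ)) h) h'⟩

theorem sub_th (α : Form) : x ⊆ th x α := fun _ h => hx.weak h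

theorem self_th (α : Form) : α ∈ th x α := hx.id α

theorem IsTh.and_iff {α β : Form} : and α β ∈ x ↔ α ∈ x ∧ β ∈ x :=
  ⟨fun h => ⟨hx.mp (hx.1 _ (IPC.andE1 _ _)) h, hx.mp (hx.1 _ (IPC.andE2 _ _)) h⟩,
   fun h => hx.mp (hx.mp (hx.1 _ (IPC.andI _ _)) h.1) h.2⟩

theorem IsTh.orl {α : Form} (β : Form) (h : α ∈ x) : or α β ∈ x :=
  hx.mp (hx.1 _ (IPC.orI1 _ _)) h

theorem IsTh.orr (α : Form) {β : Form} (h : β ∈ x) : or α β ∈ x :=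
  hx.mp (hx.1 _ (IPC.orI2 _ _)) h

theorem IsTh.orE {α β γ : Form} (h1 : imp α γ ∈ x) (h2 : imp β γ ∈ x) : imp (or α β) γ ∈ x :=
  hx.mp (hx.mp (hx.1 _ (IPC.orE _ _ _)) h1) h2

theorem IsTh.tr {α β γ : Form} (h1 : imp α β ∈ x) (h2 : imp β γ ∈ x) : imp α γ ∈ x :=
  hx.mp (hx.mp (hx.1 _ (IPC.ax2 _ _ _)) (hx.weak h2)) h1

theorem IsTh.botE (α : Form) : imp bot α ∈ x := hx.1 _ (IPC.botE _)

end

/-- Prime theories over `T`. -/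
structure PrimeTh (T x : Set Form) : Prop where
  sub : T ⊆ x
  isTh : IsTh x
  bot : bot ∉ x
  prime : ∀ α β : Form, Form.or α β ∈ x → α ∈ x ∨ β ∈ x

abbrev PT (T : Set Form) := {x : Set Form // PrimeTh T x}

theorem exists_prime {T x0 I : Set Form} (hT : T ⊆ x0) (h0 : IsTh x0)
    (hne : I.Nonempty) (hdir : ∀ i ∈ I, ∀ j ∈ I, ∃ k ∈ I, imp i k ∈ x0 ∧ imp j k ∈ x0)
    (hd : ∀ φ ∈ x0, φ ∉ I) : ∃ y : PT T, x0 ⊆ y.1 ∧ ∀ φ ∈ y.1, φ ∉ I := by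
  obtain ⟨m, hm0, hm⟩ := zorn_subset_nonempty {y : Set Form | x0 ⊆ y ∧ IsTh y ∧ ∀ φ ∈ y, φ ∉ I}
    (by
      intro c hc hch hcn
      obtain ⟨c0, hc0⟩ := hcn
      refine ⟨⋃₀ c, ⟨?_, ⟨?_, ?_⟩, ?_⟩, fun s hs => Set.subset_sUnion_of_mem hs⟩
      · exact (hc hc0).1.trans (Set.subset_sUnion_of_mem hc0)
      · intro φ h; exact ⟨c0, hc0, (hc hc0).2.1.1 φ h⟩
      · rintro φ ψ ⟨s, hs, h1⟩ ⟨t, ht, h2⟩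
        rcases hch.total hs ht with h | h
        · exact ⟨t, ht, (hc ht).2.1.mp (h h1) h2⟩
        · exact ⟨s, hs, (hc hs).2.1.mp h1 (h h2)⟩
      · rintro φ ⟨s, hs, h⟩; exact (hc hs).2.2 φ h)
    x0 ⟨le_rfl, h0, hd⟩
  obtain ⟨⟨hxm, hth, hdis⟩, hmax⟩ := hm
  have key : ∀ α, α ∉ m → ∃ i ∈ I, imp α i ∈ m := by
    intro α hα
    by_contra hcon
    push Not at hcon
    have := hmax (y := th m α) ⟨hxm.trans (sub_th hth α), isTh_th hth α,
      fun φ h1 h2 => hcon φ h2 h1⟩ (sub_th hth α)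
    exact hα (this (self_th hth α))
  refine ⟨⟨m, hT.trans hxm, hth, ?_, ?_⟩, hxm, hdis⟩
  · intro h
    obtain ⟨i, hi⟩ := hne
    exact hdis i (hth.mp (hth.botE i) h) hi
  · intro α β h
    by_contra hcon
    push Not at hcon
    obtain ⟨i, hi, h1⟩ := key α hcon.1
    obtain ⟨j, hj, h2⟩ := key β hcon.2
    obtain ⟨k, hk, h3, h4⟩ := hdir i hi j hj
    exact hdis k (hth.mp (hth.orE (hth.tr h1 (hxm h3)) (hth.tr h2 (hxm h4))) h) hk

theorem exists_prime1 {T x0 : Set Form} (hT : T ⊆ x0) (h0 : IsTh x0) {β : Form} (hβ : β ∉ x0) :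
    ∃ y : PT T, x0 ⊆ y.1 ∧ β ∉ y.1 := by
  obtain ⟨y, h1, h2⟩ := exists_prime (I := {β}) hT h0 ⟨β, rfl⟩
    (by rintro i rfl j rfl; exact ⟨_, rfl, h0.id _, h0.id _⟩)
    (by rintro φ h rfl; exact hβ h)
  exact ⟨y, h1, fun h => h2 _ h rfl⟩

section
variable {T : Set Form}

theorem PT.th (x : PT T) : IsTh x.1 := x.2.isTh

theorem PT.or_iff (x : PT T) {α β : Form} : or α β ∈ x.1 ↔ α ∈ x.1 ∨ β ∈ x.1 :=
  ⟨x.2.prime α β, fun h => h.elim (x.th.orl β) (x.th.orr α)⟩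

theorem PT.top (x : PT T) : top ∈ x.1 := x.th.1 _ IPC.topI

theorem PT.not_imp (x : PT T) {α β : Form} (h : imp α β ∉ x.1) :
    ∃ y : PT T, x ≤ y ∧ α ∈ y.1 ∧ β ∉ y.1 := by
  obtain ⟨y, h1, h2⟩ := exists_prime1 (x.2.sub.trans (sub_th x.th α)) (isTh_th x.th α) h
  exact ⟨y, (sub_th x.th α).trans h1, h1 (self_th x.th α), h2⟩

theorem PT.imp_iff (x : PT T) {α β : Form} :
    imp α β ∈ x.1 ↔ ∀ y : PT T, x ≤ y → α ∈ y.1 → β ∈ y.1 := by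
  refine ⟨fun h y hy ha => y.th.mp (hy h) ha, fun h => ?_⟩
  by_contra hc
  obtain ⟨y, h1, h2, h3⟩ := x.not_imp hc
  exact h3 (h y h1 h2)

/-- Agreement on formulas of depth at most `n`. -/
def Eqv (n : ℕ) (x y : PT T) : Prop := ∀ χ : Form, χ.depth ≤ n → (χ ∈ x.1 ↔ χ ∈ y.1)

/-- Agreement on variables. -/
def Col (x y : PT T) : Prop := ∀ i, var i ∈ x.1 ↔ var i ∈ y.1

theorem Eqv.col {n : ℕ} {x y : PT T} (h : Eqv n x y) : Col x y :=
  fun i => h (var i) (Nat.zero_le _)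

theorem Eqv.symm {n : ℕ} {x y : PT T} (h : Eqv n x y) : Eqv n y x :=
  fun χ hχ => (h χ hχ).symm

theorem Eqv.trans {n : ℕ} {x y z : PT T} (h : Eqv n x y) (h' : Eqv n y z) : Eqv n x z :=
  fun χ hχ => (h χ hχ).trans (h' χ hχ)

theorem Eqv.mono {n m : ℕ} (hnm : m ≤ n) {x y : PT T} (h : Eqv n x y) : Eqv m x y :=
  fun χ hχ => h χ (hχ.trans hnm)

theorem back_forth' {n : ℕ} {x y y' : PT T}
    (h : ∀ χ : Form, χ.depth ≤ n + 1 → χ ∈ x.1 → χ ∈ y.1) (hy : y ≤ y') :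
    ∃ x' : PT T, x ≤ x' ∧ Eqv n x' y' := by
  have hsub : x.1 ⊆ {β | ∃ α, α.depth ≤ n ∧ α ∈ y'.1 ∧ imp α β ∈ x.1} :=
    fun φ hφ => ⟨top, Nat.zero_le _, y'.top, x.th.weak hφ⟩
  have h0 : IsTh {β | ∃ α, α.depth ≤ n ∧ α ∈ y'.1 ∧ imp α β ∈ x.1} := by
    refine ⟨fun φ hφ => hsub (x.th.1 _ hφ), ?_⟩
    rintro φ ψ ⟨α, a1, a2, a3⟩ ⟨β, b1, b2, b3⟩
    refine ⟨and α β, by simp [depth, a1, b1], y'.th.and_iff.2 ⟨a2, b2⟩, ?_⟩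
    have ht := isTh_th x.th (and α β)
    have hs := ht.and_iff.1 (self_th x.th (and α β))
    exact ht.mp (ht.mp (sub_th x.th _ a3) hs.1) (ht.mp (sub_th x.th _ b3) hs.2)
  obtain ⟨z, hz1, hz2⟩ := exists_prime (T := T) (I := {β | β.depth ≤ n ∧ β ∉ y'.1})
    (x.2.sub.trans hsub) h0 ⟨bot, Nat.zero_le _, y'.2.bot⟩
    (by
      rintro i ⟨i1, i2⟩ j ⟨j1, j2⟩
      refine ⟨or i j, ⟨by simp [depth, i1, j1], ?_⟩, h0.1 _ (IPC.orI1 _ _), h0.1 _ (IPC.orI2 _ _)⟩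
      rw [y'.or_iff]; tauto)
    (by
      rintro φ ⟨α, a1, a2, a3⟩ ⟨b1, b2⟩
      have : imp α φ ∈ y.1 := h _ (by simp [depth, a1, b1]) a3
      exact b2 (y'.th.mp (hy this) a2))
  refine ⟨z, hsub.trans hz1, fun χ hχ => ⟨fun h1 => ?_, fun h1 => ?_⟩⟩
  · by_contra h2; exact hz2 χ h1 ⟨hχ, h2⟩
  · exact hz1 ⟨χ, hχ, h1, x.th.id χ⟩

theorem back_forth {n : ℕ} {x y x' : PT T} (h : Eqv (n + 1) x y) (hx : x ≤ x') :
    ∃ y' : PT T, y ≤ y' ∧ Eqv n x' y' := by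
  obtain ⟨z, h1, h2⟩ := back_forth' (fun χ hχ => (h χ hχ).2) hx
  exact ⟨z, h1, h2.symm⟩

theorem uniform_of_rigid (hT : IsTh T) {n : ℕ} (hr : ∀ x y : PT T, Eqv n x y → x = y)
    (ψ : Form) : ∃ ψ' : Form, ψ'.depth ≤ n + 1 ∧ Form.iff ψ ψ' ∈ T := by
  by_cases hc : ∃ χ : Form, χ.depth ≤ n + 1 ∧ imp χ ψ ∈ T ∧ imp ψ χ ∈ T
  · obtain ⟨χ, h1, h2, h3⟩ := hc
    exact ⟨χ, h1, hT.and_iff.2 ⟨h3, h2⟩⟩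
  exfalso
  push Not at hc
  have hth := isTh_th hT ψ
  obtain ⟨x, hx1, hx2⟩ := exists_prime (T := T) (I := {χ | χ.depth ≤ n + 1 ∧ imp χ ψ ∈ T})
    (sub_th hT ψ) hth ⟨bot, Nat.zero_le _, hT.botE _⟩
    (by
      rintro i ⟨i1, i2⟩ j ⟨j1, j2⟩
      exact ⟨or i j, ⟨by simp [depth, i1, j1], hT.orE i2 j2⟩, hth.1 _ (IPC.orI1 _ _),
        hth.1 _ (IPC.orI2 _ _)⟩)
    (by
      rintro φ h1 ⟨h2, h3⟩
      exact hc φ h2 h3 h1)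
  have hsub : T ⊆ {β | ∃ α, α.depth ≤ n + 1 ∧ α ∈ x.1 ∧ imp α β ∈ T} :=
    fun φ hφ => ⟨top, Nat.zero_le _, x.top, hT.weak hφ⟩
  have h0 : IsTh {β | ∃ α, α.depth ≤ n + 1 ∧ α ∈ x.1 ∧ imp α β ∈ T} := by
    refine ⟨fun φ hφ => hsub (hT.1 _ hφ), ?_⟩
    rintro φ ψ ⟨α, a1, a2, a3⟩ ⟨β, b1, b2, b3⟩
    refine ⟨and α β, by simp [depth, a1, b1], x.th.and_iff.2 ⟨a2, b2⟩, ?_⟩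
    have ht := isTh_th hT (and α β)
    have hs := ht.and_iff.1 (self_th hT (and α β))
    exact ht.mp (ht.mp (sub_th hT _ a3) hs.1) (ht.mp (sub_th hT _ b3) hs.2)
  obtain ⟨y, hy1, hy2⟩ := exists_prime1 (β := ψ) hsub h0
    (by rintro ⟨α, a1, a2, a3⟩; exact hx2 α a2 ⟨a1, a3⟩)
  obtain ⟨z, hz1, hz2⟩ := back_forth' (n := n) (x := x) (y := y)
    (fun χ h1 h2 => hy1 ⟨χ, h1, h2, hT.id χ⟩) le_rfl
  have := hr z y hz2
  subst this
  exact hy2 (hz1 (hx1 (self_th hT ψ)))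

theorem bisim_eq (S : PT T → PT T → Prop) (hc : ∀ a b, S a b → Col a b)
    (hf : ∀ a b a', S a b → a ≤ a' → ∃ b', b ≤ b' ∧ S a' b')
    (hb : ∀ a b b', S a b → b ≤ b' → ∃ a', a ≤ a' ∧ S a' b') {a b : PT T} (h : S a b) :
    a = b := by
  have key : ∀ (ψ : Form) (a b : PT T), S a b → (ψ ∈ a.1 ↔ ψ ∈ b.1) := by
    intro ψ
    induction ψ with
    | var i => exact fun a b h => hc a b h i
    | bot => exact fun a b _ => by simp [a.2.bot, b.2.bot]
    | top => exact fun a b _ => by simp [a.top, b.top]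
    | and α β h1 h2 => intro a b h; rw [a.th.and_iff, b.th.and_iff, h1 a b h, h2 a b h]
    | or α β h1 h2 => intro a b h; rw [a.or_iff, b.or_iff, h1 a b h, h2 a b h]
    | imp α β h1 h2 =>
      intro a b h
      rw [a.imp_iff, b.imp_iff]
      constructor
      · intro hh b' hb' hα
        obtain ⟨a', ha', hs⟩ := hb a b b' h hb'
        exact (h2 a' b' hs).1 (hh a' ha' ((h1 a' b' hs).2 hα))
      · intro hh a' ha' hα
        obtain ⟨b', hb', hs⟩ := hf a b a' h ha'
        exact (h2 a' b' hs).2 (hh b' hb' ((h1 a' b' hs).1 hα))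
  exact Subtype.ext (Set.ext fun ψ => key ψ a b h)

end

/-! ## Frame conditions -/

/-- Base theories containing all instances of the axioms of `Box`. -/
structure BoxT (T : Set Form) : Prop where
  isTh : IsTh T
  wpl : ∀ p q : Form, Form.or (imp q p) (imp (imp (imp p q) p) p) ∈ T
  bw : ∀ p q r : Form,
    Form.or (imp p (Form.or q r)) (Form.or (imp q (Form.or p r)) (imp r (Form.or p q))) ∈ T
  kc : ∀ p : Form, Form.or (neg p) (neg (neg p)) ∈ T

/-- Incomparability. -/
def Inc {T : Set Form} (a b : PT T) : Prop := ¬ a ≤ b ∧ ¬ b ≤ a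

section
variable {T : Set Form}

theorem Inc.symm {a b : PT T} (h : Inc a b) : Inc b a := ⟨h.2, h.1⟩

theorem sep {a b : PT T} (h : ¬ a ≤ b) : ∃ φ, φ ∈ a.1 ∧ φ ∉ b.1 := Set.not_subset.1 h

theorem sep2 {a b c : PT T} (h : ¬ a ≤ b) (h' : ¬ a ≤ c) :
    ∃ φ, φ ∈ a.1 ∧ φ ∉ b.1 ∧ φ ∉ c.1 := by
  obtain ⟨φ, h1, h2⟩ := sep h
  obtain ⟨ψ, h3, h4⟩ := sep h'
  exact ⟨Form.and φ ψ, a.th.and_iff.2 ⟨h1, h3⟩, fun h => h2 (b.th.and_iff.1 h).1,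
    fun h => h4 (c.th.and_iff.1 h).2⟩

theorem tri {a b : PT T} (h : ¬ Inc a b) : a < b ∨ a = b ∨ b < a := by
  unfold Inc at h
  by_cases h1 : a ≤ b
  · rcases h1.lt_or_eq with h2 | h2
    · exact Or.inl h2
    · exact Or.inr (Or.inl h2)
  · have h2 : b ≤ a := by tauto
    exact Or.inr (Or.inr (lt_of_le_not_ge h2 h1))

variable (hT : BoxT T)
include hT

theorem width {x a b c : PT T} (ha : x ≤ a) (hb : x ≤ b) (hc : x ≤ c)
    (hab : Inc a b) (hac : Inc a c) (hbc : Inc b c) : False := by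
  obtain ⟨p, p1, p2, p3⟩ := sep2 hab.1 hac.1
  obtain ⟨q, q1, q2, q3⟩ := sep2 hab.2 hbc.1
  obtain ⟨r, r1, r2, r3⟩ := sep2 hac.2 hbc.2
  have := x.2.sub (hT.bw p q r)
  rw [x.or_iff, x.or_iff] at this
  rcases this with h | h | h
  · have := a.or_iff.1 (a.th.mp (ha h) p1); tauto
  · have := b.or_iff.1 (b.th.mp (hb h) q1); tauto
  · have := c.or_iff.1 (c.th.mp (hc h) r1); tauto

theorem kc {x a b : PT T} (ha : x ≤ a) (hb : x ≤ b) : ∃ c, a ≤ c ∧ b ≤ c := by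
  have h0 : IsTh {β | ∃ α ∈ b.1, imp α β ∈ a.1} := by
    refine ⟨fun φ hφ => ⟨top, b.top, a.th.weak (a.th.1 _ hφ)⟩, ?_⟩
    rintro φ ψ ⟨α, a2, a3⟩ ⟨β, b2, b3⟩
    refine ⟨Form.and α β, b.th.and_iff.2 ⟨a2, b2⟩, ?_⟩
    have ht := isTh_th a.th (Form.and α β)
    have hs := ht.and_iff.1 (self_th a.th (Form.and α β))
    exact ht.mp (ht.mp (sub_th a.th _ a3) hs.1) (ht.mp (sub_th a.th _ b3) hs.2)
  have hs : a.1 ⊆ {β | ∃ α ∈ b.1, imp α β ∈ a.1} := fun φ hφ => ⟨top, b.top, a.th.weak hφ⟩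
  obtain ⟨c, h1, -⟩ := exists_prime1 (T := T) (β := bot) (a.2.sub.trans hs) h0 (by
    rintro ⟨α, h1, h2⟩
    have := x.2.sub (hT.kc α)
    rw [x.or_iff] at this
    rcases this with h | h
    · exact b.2.bot (b.th.mp (hb h) h1)
    · exact a.2.bot (a.th.mp (ha h) h2))
  exact ⟨c, hs.trans h1, fun φ hφ => h1 ⟨φ, hφ, a.th.id φ⟩⟩

theorem lay {x u v z : PT T} (hu : x ≤ u) (hv : x ≤ v) (huv : Inc u v) (huz : u < z) :
    v ≤ z := by
  by_contra hvz
  obtain ⟨hle, hnle⟩ := lt_iff_le_not_ge.1 huz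
  obtain ⟨a0, a1, a2⟩ := sep hnle
  obtain ⟨c, c1, c2⟩ := sep huv.1
  obtain ⟨b, b1, b2⟩ := sep hvz
  obtain ⟨β, e1, e2⟩ := sep huv.2
  obtain ⟨a, az, au, av⟩ : ∃ a, a ∈ z.1 ∧ a ∉ u.1 ∧ a ∉ v.1 :=
    ⟨Form.and a0 c, z.th.and_iff.2 ⟨a1, hle c1⟩, fun h => a2 (u.th.and_iff.1 h).1,
      fun h => c2 (v.th.and_iff.1 h).2⟩
  have hzv : Inc z v := ⟨fun h => huv.1 (hle.trans h), hvz⟩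
  have hinc : ∀ w : PT T, u ≤ w → w ≤ z → Inc w v := fun w h1 h2 =>
    ⟨fun h => huv.1 (h1.trans h), fun h => hvz (h.trans h2)⟩
  let W : Set (PT T) := {w | u ≤ w ∧ w ≤ z ∧ a ∉ w.1}
  have huW : u ∈ W := ⟨le_rfl, hle, au⟩
  have hch : ∀ w ∈ W, ∀ w' ∈ W, w ≤ w' ∨ w' ≤ w := by
    intro w hw w' hw'
    by_contra hcon
    push Not at hcon
    exact width hT (hu.trans hw.1) (hu.trans hw'.1) hv ⟨hcon.1, hcon.2⟩
      (hinc w hw.1 hw.2.1) (hinc w' hw'.1 hw'.2.1)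
  let U : PT T := ⟨{φ | ∃ w ∈ W, φ ∈ w.1}, by
    refine ⟨fun φ h => ⟨u, huW, u.2.sub h⟩, ⟨fun φ h => ⟨u, huW, u.th.1 _ h⟩, ?_⟩, ?_, ?_⟩
    · rintro φ ψ ⟨w, hw, h1⟩ ⟨w', hw', h2⟩
      rcases hch w hw w' hw' with h | h
      · exact ⟨w', hw', w'.th.mp (h h1) h2⟩
      · exact ⟨w, hw, w.th.mp h1 (h h2)⟩
    · rintro ⟨w, hw, h⟩; exact w.2.bot h
    · rintro α β ⟨w, hw, h⟩
      rcases w.or_iff.1 h with h | h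
      · exact Or.inl ⟨w, hw, h⟩
      · exact Or.inr ⟨w, hw, h⟩⟩
  have huU : u ≤ U := fun φ h => ⟨u, huW, h⟩
  have hUz : U ≤ z := by rintro φ ⟨w, hw, h⟩; exact hw.2.1 h
  have haU : a ∉ U.1 := by rintro ⟨w, hw, h⟩; exact hw.2.2 h
  have hmax : ∀ w : PT T, U ≤ w → w ≤ z → a ∉ w.1 → w = U := fun w h1 h2 h3 =>
    le_antisymm (fun φ h => ⟨w, ⟨huU.trans h1, h2, h3⟩, h⟩) h1
  have hUv := hinc U huU hUz
  obtain ⟨γ, g1, g2⟩ := sep hUv.2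
  have hxU := hu.trans huU
  have hpU : Form.or a (Form.and c γ) ∉ U.1 := by
    rw [U.or_iff, U.th.and_iff]; tauto
  have hpv : Form.or a (Form.and c γ) ∉ v.1 := by
    rw [v.or_iff, v.th.and_iff]; tauto
  have := x.2.sub (hT.wpl (Form.or a (Form.and c γ)) b)
  rw [x.or_iff] at this
  rcases this with h | h
  · exact hpv (v.th.mp (hv h) b1)
  · have h1 : imp (imp (Form.or a (Form.and c γ)) b) (Form.or a (Form.and c γ)) ∉ U.1 :=
      fun h2 => hpU (U.th.mp (hxU h) h2)
    obtain ⟨w, w1, w2, w3⟩ := U.not_imp h1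
    have hwU : w = U := by
      have w4 : a ∉ w.1 := fun h => w3 (w.or_iff.2 (Or.inl h))
      by_cases hwz : w ≤ z
      · exact hmax w w1 hwz w4
      · exfalso
        have hvw : ¬ v ≤ w := fun h => w3 (w.or_iff.2 (Or.inr (w.th.and_iff.2
          ⟨w1 (huU c1), h g1⟩)))
        refine width hT (hxU.trans w1) (hxU.trans hUz) hv ⟨hwz, fun h => w4 (h az)⟩
          ⟨fun h => hUv.1 (w1.trans h), hvw⟩ hzv
    subst hwU
    exact b2 (z.th.mp (hUz w2) (z.th.orl _ az))

theorem inc_col {x a b : PT T} (ha : x ≤ a) (hb : x ≤ b) (hab : Inc a b) : ¬ Col a b := by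
  intro hc
  have : a = b := by
    refine bisim_eq (fun s t => s = t ∨ (s = a ∧ t = b)) ?_ ?_ ?_ (Or.inr ⟨rfl, rfl⟩)
    · rintro s t (rfl | ⟨rfl, rfl⟩)
      · exact fun i => Iff.rfl
      · exact hc
    · rintro s t s' (rfl | ⟨rfl, rfl⟩) h
      · exact ⟨s', h, Or.inl rfl⟩
      · rcases h.lt_or_eq with h | rfl
        · exact ⟨s', lay hT ha hb hab h, Or.inl rfl⟩
        · exact ⟨t, le_rfl, Or.inr ⟨rfl, rfl⟩⟩
    · rintro s t t' (rfl | ⟨rfl, rfl⟩) h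
      · exact ⟨t', h, Or.inl rfl⟩
      · rcases h.lt_or_eq with h | rfl
        · exact ⟨t', lay hT hb ha hab.symm h, Or.inl rfl⟩
        · exact ⟨s, le_rfl, Or.inr ⟨rfl, rfl⟩⟩
  subst this
  exact hab.1 le_rfl

omit hT in
theorem exists_inc {p q : PT T} (hpq : p < q) (hc : Col p q) : ∃ r, p ≤ r ∧ Inc q r := by
  by_contra hcon
  push Not at hcon
  have : p = q := by
    refine bisim_eq (fun s t => s = t ∨ (p ≤ s ∧ s ≤ q ∧ t = q)) ?_ ?_ ?_
      (Or.inr ⟨le_rfl, hpq.le, rfl⟩)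
    · rintro s t (rfl | ⟨h1, h2, rfl⟩)
      · exact fun i => Iff.rfl
      · exact fun i => ⟨fun h => h2 h, fun h => h1 ((hc i).2 h)⟩
    · rintro s t s' (rfl | ⟨h1, h2, rfl⟩) h
      · exact ⟨s', h, Or.inl rfl⟩
      · rcases tri (hcon s' (h1.trans h)) with h3 | rfl | h3
        · exact ⟨s', h3.le, Or.inl rfl⟩
        · exact ⟨t, le_rfl, Or.inl rfl⟩
        · exact ⟨t, le_rfl, Or.inr ⟨h1.trans h, h3.le, rfl⟩⟩
    · rintro s t t' (rfl | ⟨h1, h2, rfl⟩) h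
      · exact ⟨t', h, Or.inl rfl⟩
      · exact ⟨t', h2.trans h, Or.inl rfl⟩
  exact hpq.ne this

theorem no_three {p q s : PT T} (h1 : p < q) (h2 : q < s) (hc : Col p s) : False := by
  have hpq : Col p q := fun i => ⟨fun h => h1.le h, fun h => (hc i).2 (h2.le h)⟩
  obtain ⟨r, hr, hqr⟩ := exists_inc h1 hpq
  have hrs := lay hT h1.le hr hqr h2
  refine inc_col hT h1.le hr hqr fun i => ?_
  exact ⟨fun h => hr ((hpq i).2 h), fun h => h1.le ((hc i).2 (hrs h))⟩

theorem finite_up {k : ℕ} (hk : ∀ i, k ≤ i → neg (var i) ∈ T) (x : PT T) :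
    {y : PT T | x ≤ y}.Finite := by
  classical
  let c : PT T → Finset ℕ := fun y => (Finset.range k).filter (fun i => var i ∈ y.1)
  have hcol : ∀ y z : PT T, c y = c z → Col y z := by
    intro y z h i
    by_cases hi : k ≤ i
    · have : ∀ w : PT T, var i ∉ w.1 := fun w h => w.2.bot (w.th.mp (w.2.sub (hk i hi)) h)
      simp [this]
    · have := Finset.ext_iff.1 h i
      simpa [c, not_le.1 hi] using this
  have hcmp : ∀ y z : PT T, x ≤ y → x ≤ z → c y = c z → y < z ∨ y = z ∨ z < y :=
    fun y z hy hz h => tri fun hi => inc_col hT hy hz hi (hcol _ _ h)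
  refine Set.Finite.of_finite_fibers c ?_ ?_
  · refine Set.Finite.subset (Finset.finite_toSet (Finset.range k).powerset) ?_
    rintro _ ⟨y, -, rfl⟩
    exact Finset.mem_coe.2 (Finset.mem_powerset.2 (Finset.filter_subset _ _))
  · rintro s -
    by_contra hinf
    obtain ⟨t, ht, hcard⟩ := Set.Infinite.exists_subset_card_eq hinf 3
    obtain ⟨a, b, d, hab, had, hbd, rfl⟩ := Finset.card_eq_three.1 hcard
    have ha := ht (show a ∈ _ by simp)
    have hb := ht (show b ∈ _ by simp)
    have hd := ht (show d ∈ _ by simp)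
    simp only [Set.mem_inter_iff, Set.mem_ofPred_eq, Set.mem_preimage, Set.mem_singleton_iff] at ha hb hd
    have e1 : c a = c b := ha.2.trans hb.2.symm
    have e2 : c a = c d := ha.2.trans hd.2.symm
    have e3 : c b = c d := hb.2.trans hd.2.symm
    have n3 : ∀ p q s : PT T, p < q → q < s → c p = c s → False :=
      fun p q s h1 h2 h => no_three hT h1 h2 (hcol _ _ h)
    rcases hcmp a b ha.1 hb.1 e1 with h1 | h1 | h1
    · rcases hcmp b d hb.1 hd.1 e3 with h2 | h2 | h2
      · exact n3 _ _ _ h1 h2 e2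
      · exact hbd h2
      · rcases hcmp a d ha.1 hd.1 e2 with h3 | h3 | h3
        · exact n3 _ _ _ h3 h2 e1
        · exact had h3
        · exact n3 _ _ _ h3 h1 e3.symm
    · exact hab h1
    · rcases hcmp a d ha.1 hd.1 e2 with h2 | h2 | h2
      · exact n3 _ _ _ h1 h2 e3
      · exact had h2
      · rcases hcmp b d hb.1 hd.1 e3 with h3 | h3 | h3
        · exact n3 _ _ _ h3 h2 e1.symm
        · exact hbd h3
        · exact n3 _ _ _ h3 h1 e2.symm

end

/-! ## Stacks -/

section
variable {T : Set Form}

/-- `n + 1` consecutive two-element layers, starting from `{q, r}`. -/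
inductive Stk : ℕ → PT T → PT T → Prop
  | base (q r : PT T) : Inc q r → Stk 0 q r
  | step (n : ℕ) (q r q' r' : PT T) : Inc q r → q < q' → q < r' → r < q' → r < r' →
      (∀ w, q < w → q' ≤ w ∨ r' ≤ w) → (∀ w, r < w → q' ≤ w ∨ r' ≤ w) →
      Stk n q' r' → Stk (n + 1) q r

/-- A sequence of layers reaching a maximal point. -/
inductive MSeq : ℕ → PT T → PT T → Prop
  | base (t : PT T) : (∀ v, t ≤ v → v = t) → MSeq 0 t t
  | step (n : ℕ) (a b a' b' : PT T) : (a ≤ b → a = b) → (b ≤ a → a = b) →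
      a < a' → a < b' → b < a' → b < b' →
      (∀ w, a < w → a' ≤ w ∨ b' ≤ w) → (∀ w, b < w → a' ≤ w ∨ b' ≤ w) →
      MSeq n a' b' → MSeq (n + 1) a b

theorem Stk.inc {n : ℕ} {q r : PT T} (h : Stk n q r) : Inc q r := by
  cases h <;> assumption

theorem exists_stk (hT : BoxT T) (n : ℕ) : ∀ p q : PT T, p < q → Eqv n p q →
    ∃ r, p ≤ r ∧ Stk n q r := by
  induction n with
  | zero =>
    intro p q h he
    obtain ⟨r, hr, hi⟩ := exists_inc h he.col
    exact ⟨r, hr, Stk.base _ _ hi⟩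
  | succ n ih =>
    intro p q h he
    obtain ⟨r, hr, hi⟩ := exists_inc h he.col
    obtain ⟨q', hq', he'⟩ := back_forth he hr
    have hne : q ≠ q' := by
      rintro rfl
      exact inc_col hT h.le hr hi he'.symm.col
    have hqq : q < q' := lt_of_le_of_ne hq' hne
    have hrq : r < q' := lt_of_le_of_ne (lay hT h.le hr hi hqq) (by
      rintro rfl; exact hi.1 hq')
    obtain ⟨r', hr', hs⟩ := ih r q' hrq he'
    have hi' := hs.inc
    have hrr : r < r' := lt_of_le_of_ne hr' (by rintro rfl; exact hi'.2 hrq.le)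
    have hqr : q < r' := lt_of_le_of_ne (lay hT hr h.le hi.symm hrr) (by
      rintro rfl; exact hi'.2 hq')
    have hcov : ∀ w, r < w → q' ≤ w ∨ r' ≤ w := by
      intro w hw
      by_cases hwq : Inc q' w
      · right
        by_contra hn
        rcases tri (a := w) (b := r') (fun hwr => width hT hrq.le hrr.le hw.le hi' hwq hwr.symm)
          with h3 | rfl | h3
        · exact hi'.1 (lay hT hw.le hrq.le hwq.symm h3)
        · exact hn le_rfl
        · exact hn h3.le
      · rcases tri hwq with h3 | rfl | h3
        · exact Or.inl h3.le
        · exact Or.inl le_rfl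
        · exact (no_three hT hw h3 he'.col).elim
    refine ⟨r, hr, Stk.step n q r q' r' hi hqq hqr hrq hrr ?_ hcov hs⟩
    intro w hw
    refine hcov w (lt_of_le_of_ne (lay hT h.le hr hi hw) ?_)
    rintro rfl
    exact hi.1 hw.le

theorem exists_mseq (hT : BoxT T) {x : PT T} (hfin : {y : PT T | x ≤ y}.Finite) (N : ℕ) :
    ∀ a b : PT T, x ≤ a → x ≤ b → (a = b ∨ Inc a b) → {w : PT T | a < w}.ncard ≤ N →
      ∃ n, MSeq n a b := by
  induction N using Nat.strong_induction_on with
  | _ N ih =>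
    intro a b ha hb hab hN
    have hfa : {w : PT T | a < w}.Finite := hfin.subset fun w hw => ha.trans hw.le
    have hba : ∀ w, b < w → a < w := by
      intro w hw
      rcases hab with rfl | hab
      · exact hw
      · exact lt_of_le_of_ne (lay hT hb ha hab.symm hw) (by rintro rfl; exact hab.2 hw.le)
    have hab' : ∀ w, a < w → b < w := by
      intro w hw
      rcases hab with rfl | hab
      · exact hw
      · exact lt_of_le_of_ne (lay hT ha hb hab hw) (by rintro rfl; exact hab.1 hw.le)
    have e1 : a ≤ b → a = b := fun h => hab.elim id fun h' => (h'.1 h).elim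
    have e2 : b ≤ a → a = b := fun h => hab.elim id fun h' => (h'.2 h).elim
    by_cases hne : {w : PT T | a < w}.Nonempty
    · obtain ⟨a', ha', hmin⟩ := hfa.exists_minimal hne
      have ha' : a < a' := ha'
      have hmin' : ∀ w, a < w → ¬ w < a' := fun w hw h => (not_le_of_gt h) (hmin hw h.le)
      obtain ⟨b', hb', hab2, hcov⟩ : ∃ b', a < b' ∧ (a' = b' ∨ Inc a' b') ∧
          ∀ w, a < w → a' ≤ w ∨ b' ≤ w := by
        by_cases hex : ∃ b', a < b' ∧ Inc a' b'
        · obtain ⟨b', hb', hi⟩ := hex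
          refine ⟨b', hb', Or.inr hi, fun w hw => ?_⟩
          by_cases hwa : Inc a' w
          · right
            by_contra hn
            rcases tri (a := w) (b := b')
              (fun hwr => width hT ha'.le hb'.le hw.le hi hwa hwr.symm) with h3 | rfl | h3
            · exact hi.1 (lay hT hw.le ha'.le hwa.symm h3)
            · exact hn le_rfl
            · exact hn h3.le
          · rcases tri hwa with h3 | rfl | h3
            · exact Or.inl h3.le
            · exact Or.inl le_rfl
            · exact (hmin' w hw h3).elim
        · push Not at hex
          refine ⟨a', ha', Or.inl rfl, fun w hw => ?_⟩
          rcases tri (hex w hw) with h3 | rfl | h3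
          · exact Or.inl h3.le
          · exact Or.inl le_rfl
          · exact (hmin' w hw h3).elim
      have hlt : {w : PT T | a' < w}.ncard < {w : PT T | a < w}.ncard := by
        refine Set.ncard_lt_ncard ⟨fun w hw => ha'.trans hw, fun h => ?_⟩ hfa
        have h2 : a' < a' := h (show a' ∈ {w : PT T | a < w} from ha')
        exact lt_irrefl _ h2
      obtain ⟨n, hn⟩ := ih _ (hlt.trans_le hN) a' b' (ha.trans ha'.le) (ha.trans hb'.le) hab2 le_rfl
      exact ⟨n + 1, MSeq.step n a b a' b' e1 e2 ha' hb' (hab' _ ha') (hab' _ hb') hcov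
        (fun w hw => hcov w (hba w hw)) hn⟩
    · have hmax : ∀ v, a ≤ v → v = a := by
        intro v hv
        by_contra h
        exact hne ⟨v, lt_of_le_of_ne hv (Ne.symm h)⟩
      obtain ⟨c, h1, h2⟩ := kc hT ha hb
      have := hmax c h1
      subst this
      have := e2 h2
      subst this
      exact ⟨0, MSeq.base _ hmax⟩

theorem exists_pmor {T' : Set Form} (n : ℕ) : ∀ (q r : PT T) (a b : PT T'), Stk n q r →
    MSeq n a b → ∃ f : PT T → PT T', f q = a ∧ f r = b ∧
      (∀ w w', (q ≤ w ∨ r ≤ w) → w ≤ w' → f w ≤ f w') ∧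
      (∀ w v, (q ≤ w ∨ r ≤ w) → f w ≤ v → ∃ w', w ≤ w' ∧ f w' = v) := by
  classical
  induction n with
  | zero =>
    intro q r a b _ h
    cases h with
    | base _ h =>
      exact ⟨fun _ => a, rfl, rfl, fun _ _ _ _ => le_rfl, fun w v _ hv => ⟨w, le_rfl, (h v hv).symm⟩⟩
  | succ n ih =>
    intro q r a b hs hm
    cases hs with
    | step _ _ _ q' r' hi s1 s2 s3 s4 s5 s6 hs =>
    cases hm with
    | step _ _ _ a' b' m1 m2 m3 m4 m5 m6 m7 m8 hm =>
    obtain ⟨f, f1, f2, f3, f4⟩ := ih q' r' a' b' hs hm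
    have hqr : r ≠ q := by rintro rfl; exact hi.1 le_rfl
    let g : PT T → PT T' := fun w => if w = q then a else if w = r then b else f w
    have gq : g q = a := by simp [g]
    have gr : g r = b := by simp [g, hqr]
    have gU : ∀ w, (q' ≤ w ∨ r' ≤ w) → g w = f w := by
      intro w hw
      have h1 : q < w := hw.elim s1.trans_le s2.trans_le
      have h2 : r < w := hw.elim s3.trans_le s4.trans_le
      simp [g, h1.ne', h2.ne']
    have hcase : ∀ w, (q ≤ w ∨ r ≤ w) → w = q ∨ w = r ∨ (q' ≤ w ∨ r' ≤ w) := by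
      rintro w (h | h)
      · rcases h.lt_or_eq with h | h
        · exact Or.inr (Or.inr (s5 w h))
        · exact Or.inl h.symm
      · rcases h.lt_or_eq with h | h
        · exact Or.inr (Or.inr (s6 w h))
        · exact Or.inr (Or.inl h.symm)
    have low : ∀ w, (q' ≤ w ∨ r' ≤ w) → a < g w ∧ b < g w := by
      intro w hw
      rw [gU w hw]
      rcases hw with h | h
      · have := f3 q' w (Or.inl le_rfl) h
        rw [f1] at this
        exact ⟨m3.trans_le this, m5.trans_le this⟩
      · have := f3 r' w (Or.inr le_rfl) h
        rw [f2] at this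
        exact ⟨m4.trans_le this, m6.trans_le this⟩
    have up : ∀ v, (a' ≤ v ∨ b' ≤ v) → ∃ w', (q' ≤ w' ∨ r' ≤ w') ∧ g w' = v := by
      rintro v (h | h)
      · obtain ⟨w', h1, h2⟩ := f4 q' v (Or.inl le_rfl) (by rw [f1]; exact h)
        exact ⟨w', Or.inl h1, by rw [gU _ (Or.inl h1), h2]⟩
      · obtain ⟨w', h1, h2⟩ := f4 r' v (Or.inr le_rfl) (by rw [f2]; exact h)
        exact ⟨w', Or.inr h1, by rw [gU _ (Or.inr h1), h2]⟩
    refine ⟨g, gq, gr, ?_, ?_⟩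
    · intro w w' hw hww
      rcases hcase w hw with rfl | rfl | hw
      · rcases hcase w' (Or.inl hww) with rfl | rfl | hw'
        · exact le_rfl
        · exact (hi.1 hww).elim
        · rw [gq]; exact (low w' hw').1.le
      · rcases hcase w' (Or.inr hww) with rfl | rfl | hw'
        · exact (hi.2 hww).elim
        · exact le_rfl
        · rw [gr]; exact (low w' hw').2.le
      · have hw' : q' ≤ w' ∨ r' ≤ w' := hw.imp (fun h => h.trans hww) (fun h => h.trans hww)
        rw [gU w hw, gU w' hw']
        exact f3 w w' hw hww
    · intro w v hw hv
      rcases hcase w hw with rfl | rfl | hw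
      · rw [gq] at hv
        rcases hv.lt_or_eq with h | rfl
        · obtain ⟨w', h1, h2⟩ := up v (m7 v h)
          exact ⟨w', h1.elim (fun h => s1.le.trans h) (fun h => s2.le.trans h), h2⟩
        · exact ⟨w, le_rfl, gq⟩
      · rw [gr] at hv
        rcases hv.lt_or_eq with h | rfl
        · obtain ⟨w', h1, h2⟩ := up v (m8 v h)
          exact ⟨w', h1.elim (fun h => s3.le.trans h) (fun h => s4.le.trans h), h2⟩
        · exact ⟨w, le_rfl, gr⟩
      · rw [gU w hw] at hv
        obtain ⟨w', h1, h2⟩ := f4 w v hw hv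
        exact ⟨w', h1, by
          rw [gU w' (hw.imp (fun h => h.trans h1) (fun h => h.trans h1)), h2]⟩

theorem definable {q : PT T} (hfin : {y : PT T | q ≤ y}.Finite) (P : PT T → Prop)
    (hP : ∀ w w', q ≤ w → w ≤ w' → P w → P w') :
    ∃ δ : Form, ∀ w, q ≤ w → (δ ∈ w.1 ↔ P w) := by
  have h1 : ∀ u : PT T, ∃ δ : Form, δ ∈ u.1 ∧ ∀ w, q ≤ w → δ ∈ w.1 → u ≤ w := by
    intro u
    have key : ∀ A : Set (PT T), A.Finite →
        ∃ δ : Form, δ ∈ u.1 ∧ ∀ w ∈ A, δ ∈ w.1 → u ≤ w := by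
      intro A hA
      induction A, hA using Set.Finite.induction_on with
      | empty => exact ⟨top, u.top, by simp⟩
      | @insert a A _ _ ih =>
        obtain ⟨δ, h1, h2⟩ := ih
        by_cases ha : u ≤ a
        · refine ⟨δ, h1, ?_⟩
          rintro w (rfl | hw) h
          · exact ha
          · exact h2 w hw h
        · obtain ⟨φ, h3, h4⟩ := sep ha
          refine ⟨Form.and δ φ, u.th.and_iff.2 ⟨h1, h3⟩, ?_⟩
          rintro w (rfl | hw) h
          · exact (h4 (w.th.and_iff.1 h).2).elim
          · exact h2 w hw (w.th.and_iff.1 h).1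
    exact key _ hfin
  have key : ∀ A : Set (PT T), A.Finite → (∀ u ∈ A, q ≤ u) →
      ∃ δ : Form, (∀ w ∈ A, P w → δ ∈ w.1) ∧ ∀ w, q ≤ w → δ ∈ w.1 → P w := by
    intro A hA
    induction A, hA using Set.Finite.induction_on with
    | empty => exact fun _ => ⟨bot, by simp, fun w _ h => (w.2.bot h).elim⟩
    | @insert a A _ _ ih =>
      intro hq
      obtain ⟨δ, h2, h3⟩ := ih fun u hu => hq u (Or.inr hu)
      by_cases ha : P a
      · obtain ⟨φ, h4, h5⟩ := h1 a
        refine ⟨Form.or δ φ, ?_, ?_⟩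
        · rintro w (rfl | hw) h
          · exact w.or_iff.2 (Or.inr h4)
          · exact w.or_iff.2 (Or.inl (h2 w hw h))
        · intro w hw h
          rcases w.or_iff.1 h with h | h
          · exact h3 w hw h
          · exact hP a w (hq a (Or.inl rfl)) (h5 w hw h) ha
      · refine ⟨δ, ?_, h3⟩
        rintro w (rfl | hw) h
        · exact (ha h).elim
        · exact h2 w hw h
  obtain ⟨δ, h2, h3⟩ := key _ hfin fun _ h => h
  exact ⟨δ, fun w hw => ⟨h3 w hw, h2 w hw⟩⟩

theorem transfer {T' : Set Form} {q : PT T} (hfin : {y : PT T | q ≤ y}.Finite)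
    (f : PT T → PT T') (hm : ∀ w w', q ≤ w → w ≤ w' → f w ≤ f w')
    (hb : ∀ w v, q ≤ w → f w ≤ v → ∃ w', w ≤ w' ∧ f w' = v) :
    ∃ σ : ℕ → Form, ∀ (ψ : Form) (w : PT T), q ≤ w → (ψ.subst σ ∈ w.1 ↔ ψ ∈ (f w).1) := by
  choose σ hσ using fun i => definable hfin (fun w => var i ∈ (f w).1)
    (fun w w' h1 h2 h => hm w w' h1 h2 h)
  refine ⟨σ, fun ψ => ?_⟩
  induction ψ with
  | var i => exact hσ i
  | bot => exact fun w _ => by simp [subst, w.2.bot, (f w).2.bot]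
  | top => exact fun w _ => by simp [subst, w.top, (f w).top]
  | and α β h1 h2 =>
    intro w hw; rw [subst, w.th.and_iff, (f w).th.and_iff, h1 w hw, h2 w hw]
  | or α β h1 h2 =>
    intro w hw; rw [subst, w.or_iff, (f w).or_iff, h1 w hw, h2 w hw]
  | imp α β h1 h2 =>
    intro w hw
    rw [subst, w.imp_iff, (f w).imp_iff]
    constructor
    · intro h v hv hα
      obtain ⟨w', h3, rfl⟩ := hb w v hw hv
      exact (h2 w' (hw.trans h3)).1 (h w' h3 ((h1 w' (hw.trans h3)).2 hα))
    · intro h w' h3 hα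
      exact (h2 w' (hw.trans h3)).2 (h (f w') (hm w w' hw h3) ((h1 w' (hw.trans h3)).1 hα))

theorem rigid (hT : BoxT T) {n : ℕ} (hno : ∀ q r : PT T, ¬ Stk n q r) (x y : PT T)
    (h : Eqv (n + 2) x y) : x = y := by
  have hcmp : ∀ z a b : PT T, z ≤ a → z ≤ b → Eqv n a b → a = b := by
    intro z a b ha hb he
    rcases tri (fun hi => inc_col hT ha hb hi he.col) with h | h | h
    · obtain ⟨r, -, hr⟩ := exists_stk hT n a b h he
      exact (hno _ _ hr).elim
    · exact h
    · obtain ⟨r, -, hr⟩ := exists_stk hT n b a h he.symm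
      exact (hno _ _ hr).elim
  refine bisim_eq (fun u v => x ≤ u ∧ y ≤ v ∧ Eqv (n + 1) u v) (fun a b h => h.2.2.col) ?_ ?_
    ⟨le_rfl, le_rfl, h.mono (by omega)⟩
  · rintro u v u' ⟨h1, h2, h3⟩ hu
    obtain ⟨v', h4, h5⟩ := back_forth h (h1.trans hu)
    obtain ⟨w, h6, h7⟩ := back_forth h3 hu
    have := hcmp y w v' (h2.trans h6) h4 (h7.symm.trans (h5.mono (by omega)))
    subst this
    exact ⟨w, h6, h1.trans hu, h4, h5⟩
  · rintro u v v' ⟨h1, h2, h3⟩ hv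
    obtain ⟨u', h4, h5⟩ := back_forth h.symm (h2.trans hv)
    obtain ⟨w, h6, h7⟩ := back_forth h3.symm hv
    have := hcmp x w u' (h1.trans h6) h4 (h7.symm.trans (h5.mono (by omega)))
    subst this
    exact ⟨w, h6, h4, h2.trans hv, h5.symm⟩

end

/-! ## Logics with finitely many variables -/

/-- Replace all variables from `k` on by falsum. -/
def cut (k : ℕ) : ℕ → Form := fun i => if i < k then var i else bot

/-- The theory of `L` with all variables from `k` on replaced by falsum. -/
def Tk (L : Set Form) (k : ℕ) : Set Form := {ψ | ψ.subst (cut k) ∈ L}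

theorem subst_cut {k : ℕ} (ψ : Form) (h : ψ.varsLt k) : ψ.subst (cut k) = ψ := by
  induction ψ with
  | var i => simp only [varsLt] at h; simp [subst, cut, h]
  | bot => rfl
  | top => rfl
  | and α β h1 h2 => simp only [varsLt] at h; simp [subst, h1 h.1, h2 h.2]
  | or α β h1 h2 => simp only [varsLt] at h; simp [subst, h1 h.1, h2 h.2]
  | imp α β h1 h2 => simp only [varsLt] at h; simp [subst, h1 h.1, h2 h.2]

theorem depth_cut {k : ℕ} (ψ : Form) : (ψ.subst (cut k)).depth ≤ ψ.depth := by
  induction ψ with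
  | var i => simp only [subst, cut]; split <;> simp [depth]
  | bot => simp [subst]
  | top => simp [subst]
  | and α β h1 h2 => simp only [subst, depth]; omega
  | or α β h1 h2 => simp only [subst, depth]; omega
  | imp α β h1 h2 => simp only [subst, depth]; omega

theorem varsLt_mono {k m : ℕ} (hkm : k ≤ m) (ψ : Form) (h : ψ.varsLt k) : ψ.varsLt m := by
  induction ψ with
  | var i => simp only [varsLt] at *; omega
  | bot => trivial
  | top => trivial
  | and α β h1 h2 => exact ⟨h1 h.1, h2 h.2⟩
  | or α β h1 h2 => exact ⟨h1 h.1, h2 h.2⟩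
  | imp α β h1 h2 => exact ⟨h1 h.1, h2 h.2⟩

theorem exists_varsLt (ψ : Form) : ∃ k, ψ.varsLt k := by
  induction ψ with
  | var i => exact ⟨i + 1, Nat.lt_succ_self i⟩
  | bot => exact ⟨0, trivial⟩
  | top => exact ⟨0, trivial⟩
  | and α β h1 h2 =>
    obtain ⟨k, h1⟩ := h1
    obtain ⟨m, h2⟩ := h2
    exact ⟨max k m, varsLt_mono (le_max_left _ _) _ h1, varsLt_mono (le_max_right _ _) _ h2⟩
  | or α β h1 h2 =>
    obtain ⟨k, h1⟩ := h1
    obtain ⟨m, h2⟩ := h2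
    exact ⟨max k m, varsLt_mono (le_max_left _ _) _ h1, varsLt_mono (le_max_right _ _) _ h2⟩
  | imp α β h1 h2 =>
    obtain ⟨k, h1⟩ := h1
    obtain ⟨m, h2⟩ := h2
    exact ⟨max k m, varsLt_mono (le_max_left _ _) _ h1, varsLt_mono (le_max_right _ _) _ h2⟩

theorem oplus_logic (L Γ : Set Form) : IsSILogic (oplus L Γ) := by
  refine ⟨fun φ h M hM => hM.1.1 h, fun φ ψ h1 h2 M hM => hM.1.2.1 φ ψ (h1 M hM) (h2 M hM),
    fun φ σ h M hM => hM.1.2.2 φ σ (h M hM)⟩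

theorem sub_oplus (L Γ : Set Form) : L ⊆ oplus L Γ := fun _ h _ hM => hM.2.1 h

theorem sub_oplus' (L Γ : Set Form) : Γ ⊆ oplus L Γ := fun _ h _ hM => hM.2.2 h

theorem logic_th {L : Set Form} (hL : IsSILogic L) : IsTh L :=
  ⟨fun _ h => hL.1 h, hL.2.1⟩

theorem sub_Tk {L : Set Form} (hL : IsSILogic L) (k : ℕ) : L ⊆ Tk L k :=
  fun φ h => hL.2.2 φ _ h

theorem Tk_th {L : Set Form} (hL : IsSILogic L) (k : ℕ) : IsTh (Tk L k) :=
  ⟨fun _ h => sub_Tk hL k (hL.1 h), fun φ ψ h h' => hL.2.1 _ _ h h'⟩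

theorem Tk_neg {L : Set Form} (hL : IsSILogic L) (k i : ℕ) (hi : k ≤ i) :
    neg (var i) ∈ Tk L k := by
  have : ¬ i < k := by omega
  simp only [Tk, Set.mem_ofPred_eq, neg, subst, cut, this, if_false]
  exact (logic_th hL).id bot

theorem boxT {L : Set Form} (hL : IsSILogic L) (h : BoxLogic ⊆ L) (k : ℕ) : BoxT (Tk L k) := by
  have h1 : wPLax ∈ L := h (sub_oplus _ _ (sub_oplus' _ _ rfl))
  have h2 : bw2ax ∈ L := h (sub_oplus' _ _ (Or.inl rfl))
  have h3 : kcax ∈ L := h (sub_oplus' _ _ (Or.inr rfl))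
  refine ⟨Tk_th hL k, fun p q => ?_, fun p q r => ?_, fun p => ?_⟩
  · exact sub_Tk hL k (hL.2.2 _ (fun i => if i = 0 then p else q) h1)
  · exact sub_Tk hL k (hL.2.2 _ (fun i => if i = 0 then p else if i = 1 then q else r) h2)
  · exact sub_Tk hL k (hL.2.2 _ (fun _ => p) h3)

theorem part2 (L : Set Form) (hL : IsSILogic L) (hB : BoxLogic ⊂ L) : ∃ n, Uniform L n := by
  obtain ⟨φ, hφ, hφB⟩ := Set.exists_of_ssubset hB
  have hBL : IsSILogic BoxLogic := oplus_logic _ _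
  obtain ⟨k, hk⟩ := exists_varsLt φ
  have hT0 := boxT hBL le_rfl k
  have hφT : φ ∉ Tk BoxLogic k := by
    simp only [Tk, Set.mem_ofPred_eq, subst_cut φ hk]
    exact hφB
  obtain ⟨a, -, ha⟩ := exists_prime1 (T := Tk BoxLogic k) le_rfl hT0.isTh hφT
  obtain ⟨n, hn⟩ := exists_mseq hT0 (finite_up hT0 (Tk_neg hBL k) a) _ a a le_rfl le_rfl
    (Or.inl rfl) le_rfl
  refine ⟨n + 2 + 1, fun ψ => ?_⟩
  obtain ⟨m, hm⟩ := exists_varsLt ψ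
  have hT := boxT hL hB.1 m
  have hno : ∀ q r : PT (Tk L m), ¬ Stk n q r := by
    intro q r hs
    obtain ⟨f, f1, -, f3, f4⟩ := exists_pmor n q r a a hs hn
    obtain ⟨σ, hσ⟩ := transfer (finite_up hT (Tk_neg hL m) q) f
      (fun w w' h => f3 w w' (Or.inl h)) (fun w v h => f4 w v (Or.inl h))
    have h1 : φ.subst σ ∈ q.1 := q.2.sub (sub_Tk hL m (hL.2.2 _ _ hφ))
    rw [hσ φ q le_rfl, f1] at h1
    exact ha h1
  obtain ⟨ψ', h1, h2⟩ := uniform_of_rigid hT.isTh (rigid hT hno) ψ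
  refine ⟨ψ'.subst (cut m), (depth_cut ψ').trans h1, ?_⟩
  have h3 : (Form.iff ψ ψ').subst (cut m) ∈ L := h2
  simp only [Form.iff, subst, subst_cut ψ hm] at h3
  exact h3

/-! ## The first part -/

/-- Layer of a point. -/
def lidx : Option (ℕ × Bool) → ℕ
  | none => 0
  | some (j, _) => j + 1

/-- Colour index of a point. -/
def crank : Option (ℕ × Bool) → ℕ
  | none => 0
  | some (j, false) => j + 1
  | some (j, true) => j + 2

/-- The infinite layered frame with a top point. -/
def InfF : Frame where
  W := Option (ℕ × Bool)
  le a b := a = b ∨ lidx b < lidx a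
  refl _ := Or.inl rfl
  trans := by
    rintro a b c (rfl | h1) h2
    · exact h2
    · rcases h2 with rfl | h2
      · exact Or.inr h1
      · exact Or.inr (h2.trans h1)
  antisymm := by
    rintro a b (rfl | h1) h2
    · rfl
    · rcases h2 with rfl | h2
      · rfl
      · omega

theorem force_mono (F : Frame) {V : ℕ → F.W → Prop} (hV : F.Persistent V) (φ : Form) :
    ∀ w v, F.le w v → F.force V φ w → F.force V φ v := by
  induction φ with
  | var i => exact fun w v h => hV i w v h
  | bot => exact fun _ _ _ h => h
  | top => exact fun _ _ _ h => h
  | and α β h1 h2 => exact fun w v h hh => ⟨h1 w v h hh.1, h2 w v h hh.2⟩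
  | or α β h1 h2 => exact fun w v h hh => hh.imp (h1 w v h) (h2 w v h)
  | imp α β h1 h2 => exact fun w v h hh u hu => hh u (F.trans _ _ _ h hu)

theorem force_subst (F : Frame) (V : ℕ → F.W → Prop) (σ : ℕ → Form) (φ : Form) :
    ∀ w, F.force V (φ.subst σ) w ↔ F.force (fun i w => F.force V (σ i) w) φ w := by
  induction φ with
  | var i => exact fun w => Iff.rfl
  | bot => exact fun w => Iff.rfl
  | top => exact fun w => Iff.rfl
  | and α β h1 h2 => intro w; simp only [subst, Frame.force, h1, h2]
  | or α β h1 h2 => intro w; simp only [subst, Frame.force, h1, h2]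
  | imp α β h1 h2 => intro w; simp only [subst, Frame.force, h1, h2]

theorem sound (F : Frame) {V : ℕ → F.W → Prop} (hV : F.Persistent V) (φ : Form) (h : IPC φ) :
    ∀ w, F.force V φ w := by
  induction h with
  | ax1 φ ψ => exact fun w v _ h u hu _ => force_mono F hV φ v u hu h
  | ax2 φ ψ χ =>
    exact fun w v _ h u hu h' t ht h'' =>
      h t (F.trans _ _ _ hu ht) h'' t (F.refl t) (h' t ht h'')
  | andE1 φ ψ => exact fun w v _ h => h.1
  | andE2 φ ψ => exact fun w v _ h => h.2
  | andI φ ψ => exact fun w v _ h u hu h' => ⟨force_mono F hV φ v u hu h, h'⟩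
  | orI1 φ ψ => exact fun w v _ h => Or.inl h
  | orI2 φ ψ => exact fun w v _ h => Or.inr h
  | orE φ ψ χ =>
    exact fun w v _ h u hu h' t ht h'' =>
      h''.elim (h t (F.trans _ _ _ hu ht)) (h' t ht)
  | botE φ => exact fun w v _ h => h.elim
  | topI => exact fun w => trivial
  | mp φ ψ _ _ h1 h2 => exact fun w => h1 w w (F.refl w) (h2 w)

theorem frameLog_logic (F : Frame) : IsSILogic (FrameLog F) := by
  refine ⟨fun φ h V hV => sound F hV φ h, fun φ ψ h1 h2 V hV w => h1 V hV w w (F.refl w) (h2 V hV w),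
    fun φ σ h V hV w => ?_⟩
  rw [force_subst]
  exact h _ (fun i a b hab => force_mono F hV (σ i) a b hab) w

theorem inf_total {a b : InfF.W} (h : lidx a ≠ lidx b) : InfF.le a b ∨ InfF.le b a := by
  rcases lt_or_gt_of_ne h with h | h
  · exact Or.inr (Or.inr h)
  · exact Or.inl (Or.inr h)

theorem inf_wpl : InfF.Valid wPLax := by
  intro V hV w
  by_contra hcon
  simp only [wPLax, Frame.force] at hcon
  push Not at hcon
  obtain ⟨⟨v, hv, hq, hp⟩, u, hu, hpu, hnu⟩ := hcon
  have hz : ∃ z, InfF.le u z ∧ V 0 z ∧ ¬ V 1 z := by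
    by_contra hc
    push Not at hc
    exact hnu (hpu u (InfF.refl u) hc)
  obtain ⟨z, hz1, hz2, hz3⟩ := hz
  have hvz : InfF.le v z ∨ InfF.le u v := by
    by_cases h : lidx u = lidx v
    · rcases hz1 with rfl | hz1
      · exact (hnu hz2).elim
      · left; right; omega
    · rcases inf_total h with h | h
      · exact Or.inr h
      · exact Or.inl (InfF.trans _ _ _ h hz1)
  rcases hvz with h | h
  · exact hz3 (hV 1 _ _ h hq)
  · exact hp (hpu v h fun t ht _ => hV 1 _ _ ht hq)

theorem lidx_three : ∀ a b c : Option (ℕ × Bool), a ≠ b → a ≠ c → b ≠ c →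
    lidx a = lidx b → lidx a = lidx c → False := by
  intro a b c n1 n2 n3 e1 e2
  rcases a with _ | ⟨i, _ | _⟩ <;> rcases b with _ | ⟨j, _ | _⟩ <;>
    rcases c with _ | ⟨k, _ | _⟩ <;> simp_all [lidx]

theorem inf_bw : InfF.Valid bw2ax := by
  intro V hV w
  by_contra hcon
  simp only [bw2ax, Frame.force] at hcon
  push Not at hcon
  obtain ⟨⟨a, -, a1, a2, a3⟩, ⟨b, -, b1, b2, b3⟩, c, -, c1, c2, c3⟩ := hcon
  have key : ∀ (s t : InfF.W) (i j : ℕ), V i s → ¬ V j s → V j t → ¬ V i t →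
      s ≠ t ∧ lidx s = lidx t := by
    intro s t i j h1 h2 h3 h4
    refine ⟨by rintro rfl; exact h4 h1, ?_⟩
    by_contra h
    rcases inf_total h with h | h
    · exact h4 (hV _ _ _ h h1)
    · exact h2 (hV _ _ _ h h3)
  obtain ⟨n1, e1⟩ := key a b 0 1 a1 a2 b1 b2
  obtain ⟨n2, e2⟩ := key a c 0 2 a1 a3 c1 c2
  obtain ⟨n3, e3⟩ := key b c 1 2 b1 b3 c1 c3
  exact lidx_three a b c n1 n2 n3 e1 e2

theorem inf_kc : InfF.Valid kcax := by
  intro V hV w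
  have htop : ∀ v : InfF.W, InfF.le v none := by
    intro v
    change Option (ℕ × Bool) at v
    rcases v with _ | ⟨j, s⟩
    · exact Or.inl rfl
    · right; simp [lidx]
  by_cases h : V 0 none
  · right
    intro v _ hv
    exact hv none (htop v) h
  · left
    intro v _ hv
    exact h (hV 0 v none (htop v) hv)

theorem box_sub : BoxLogic ⊆ FrameLog InfF := by
  have hw : wPL ⊆ FrameLog InfF := by
    intro φ h
    refine h _ ⟨frameLog_logic _, (frameLog_logic _).1, ?_⟩
    rintro _ rfl
    exact inf_wpl
  intro φ h
  refine h _ ⟨frameLog_logic _, hw, ?_⟩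
  rintro _ (rfl | rfl)
  · exact inf_bw
  · exact inf_kc

/-- The valuation on the infinite frame. -/
def InfV : ℕ → InfF.W → Prop := fun i w => crank w ≤ i

theorem crank_bounds (w : Option (ℕ × Bool)) : lidx w ≤ crank w ∧ crank w ≤ lidx w + 1 := by
  rcases w with _ | ⟨j, _ | _⟩ <;> simp [lidx, crank]

theorem infV_pers : InfF.Persistent InfV := by
  rintro i a b (rfl | h) hv
  · exact hv
  · have h1 := crank_bounds a
    have h2 := crank_bounds b
    simp only [InfV] at *
    omega

theorem inf_agree (ψ : Form) : ∀ j, ψ.depth ≤ j →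
    (InfF.force InfV ψ (some (j, true)) ↔ InfF.force InfV ψ (some (j + 1, false))) := by
  induction ψ with
  | var i =>
    intro j _
    change j + 2 ≤ i ↔ j + 1 + 1 ≤ i
    exact Iff.rfl
  | bot => exact fun _ _ => Iff.rfl
  | top => exact fun _ _ => Iff.rfl
  | and α β h1 h2 =>
    intro j hj
    simp only [depth] at hj
    simp only [Frame.force, h1 j (by omega), h2 j (by omega)]
  | or α β h1 h2 =>
    intro j hj
    simp only [depth] at hj
    simp only [Frame.force, h1 j (by omega), h2 j (by omega)]
  | imp α β h1 h2 =>
    intro j hj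
    simp only [depth] at hj
    constructor
    · intro h v hv hα
      have hb : InfF.le (some (j, true)) v → InfF.force InfV β v := fun hle => h v hle hα
      rcases hv with rfl | hv
      · rw [← h2 j (by omega)]
        exact h _ (InfF.refl _) ((h1 j (by omega)).2 hα)
      · change Option (ℕ × Bool) at v
        by_cases hlt : lidx v < j + 1
        · exact hb (Or.inr hlt)
        · have hv' : lidx v = j + 1 := by
            have hv : lidx v < j + 1 + 1 := hv
            omega
          rcases v with _ | ⟨i, _ | _⟩
          · simp [lidx] at hv'
          · have hi : i = j := by simpa [lidx] using hv'
            subst hi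
            obtain ⟨i, rfl⟩ : ∃ i', i = i' + 1 := ⟨i - 1, by omega⟩
            rw [← h2 i (by omega)]
            exact h _ (Or.inr (by simp [lidx])) ((h1 i (by omega)).2 hα)
          · have hi : i = j := by simpa [lidx] using hv'
            subst hi
            exact hb (Or.inl rfl)
    · intro h
      exact force_mono InfF infV_pers (imp α β) _ _ (Or.inr (by simp [lidx])) h

/-- Distinguishing formulas. -/
def chi : ℕ → Form
  | 0 => imp (var 1) (var 0)
  | j + 1 => imp (var (j + 2)) (Form.or (var (j + 1)) (chi j))

theorem inf_nle (i : ℕ) : ¬ InfF.le (some (i, true)) (some (i, false)) := by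
  rintro (h | h)
  · have h : (some (i, true) : Option (ℕ × Bool)) = some (i, false) := h
    simp at h
  · have h : i + 1 < i + 1 := h
    omega

theorem chi_spec (j : ℕ) : ∀ w : InfF.W,
    InfF.force InfV (chi j) w ↔ ¬ InfF.le w (some (j, false)) := by
  induction j with
  | zero =>
    intro w
    constructor
    · intro h hle
      have := h _ hle (by simp [Frame.force, InfV, crank])
      simp [Frame.force, InfV, crank] at this
    · intro h v hv hv1
      change Option (ℕ × Bool) at v
      simp only [Frame.force, InfV] at hv1 ⊢
      rcases v with _ | ⟨i, _ | _⟩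
      · simp [crank]
      · have : i = 0 := by simpa [crank] using hv1
        subst this
        exact (h hv).elim
      · simp [crank] at hv1
  | succ j ih =>
    intro w
    constructor
    · intro h hle
      have := h _ hle (by simp [Frame.force, InfV, crank])
      rcases this with h | h
      · have h : j + 1 + 1 ≤ j + 1 := h
        omega
      · exact (ih _).1 h (Or.inr (by simp [lidx]))
    · intro h v hv hv1
      change Option (ℕ × Bool) at v
      have hv1 : crank v ≤ j + 2 := hv1
      by_cases hc : crank v ≤ j + 1
      · exact Or.inl hc
      · right
        refine (ih v).2 ?_
        rcases v with _ | ⟨i, _ | _⟩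
        · simp [crank] at hc
        · have : i = j + 1 := by simp only [crank] at hc hv1; omega
          subst this
          exact (h hv).elim
        · have : i = j := by simp only [crank] at hc hv1; omega
          subst this
          exact inf_nle i

theorem part1 : ¬ ∃ n, Uniform BoxLogic n := by
  rintro ⟨n, hn⟩
  obtain ⟨ψ, h1, h2⟩ := hn (chi n)
  have h3 := fun w => box_sub h2 InfV infV_pers w
  have h4 : ∀ w, InfF.force InfV (chi n) w ↔ InfF.force InfV ψ w := fun w =>
    ⟨(h3 w).1 w (InfF.refl w), (h3 w).2 w (InfF.refl w)⟩
  have h5 := inf_agree ψ n h1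
  have hb := (chi_spec n (some (n, true))).2 (inf_nle n)
  have ha := (h4 _).2 (h5.1 ((h4 _).1 hb))
  exact (chi_spec n _).1 ha (Or.inr (by simp [lidx]))

end BoxProof

/-- The logic `Box` is pre-uniformly locally tabular: it is
not uniformly locally tabular, but every superintuitionistic logic properly
extending it is uniformly locally tabular. -/
theorem statement19 :
    (¬ ∃ n, Uniform BoxLogic n) ∧
    (∀ L : Set Form, IsSILogic L → BoxLogic ⊂ L → ∃ n, Uniform L n) := by
  exact ⟨BoxProof.part1, BoxProof.part2⟩
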